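/- arXiv:2109.06314 — 2 statements merged into one kernel-verified Lean document; each statement's English description precedes it below -/
import Mathlib

section
/- Let (b_n)_{n≥1} be a sequence of positive reals such that n ↦ n·b_n is non-decreasing, and let a > 1 and θ > 0. Then: if ∑_{k=1}^∞ exp(−θ ⌊a^k⌋ b_{⌊a^{k+1}⌋}) < ∞, then ∑_{n=1}^∞ b_n exp(−n θ b_n) < ∞; and if ∑_{n=1}^∞ b_n exp(−n θ b_n) < ∞, then ∑_{k=1}^∞ exp(−θ ⌊a^k⌋ b_{⌊a^k⌋}) < ∞. -/
open Filter

lemma tendsto_floor_pow_succ_div_floor_pow {a : ℝ} (ha : 1 < a) :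
    Tendsto (fun k : ℕ => (⌊a ^ (k + 1)⌋₊ : ℝ) / ⌊a ^ k⌋₊) atTop (nhds a) := by
  have h : Tendsto (fun k : ℕ => (⌊a ^ k⌋₊ : ℝ) / a ^ k) atTop (nhds 1) :=
    tendsto_nat_floor_div_atTop.comp (tendsto_pow_atTop_atTop_of_one_lt ha)
  have h1 := (h.comp (tendsto_add_atTop_nat 1)).div h one_ne_zero
  have h2 := h1.mul_const a
  simp only [div_one, one_mul] at h2
  refine h2.congr fun k => ?_
  have hk : (0 : ℝ) < a ^ k := by positivity
  have hf : 1 ≤ ⌊a ^ k⌋₊ := Nat.one_le_floor_iff _ |>.2 (one_le_pow₀ ha.le)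
  have hf' : (0 : ℝ) < ⌊a ^ k⌋₊ := by exact_mod_cast hf
  simp only [Function.comp, Pi.div_apply, pow_succ]
  field_simp

/-- Eventually the integer parts of the powers of `a > 1` grow by factors which stay away from `1`
and from infinity. -/
lemma exists_floor_pow_succ_bounds {a : ℝ} (ha : 1 < a) :
    ∃ K : ℕ, ∀ k, K ≤ k →
      (1 + (a - 1) / 2) * (⌊a ^ k⌋₊ : ℝ) ≤ ⌊a ^ (k + 1)⌋₊ ∧
        (⌊a ^ (k + 1)⌋₊ : ℝ) ≤ (a + 1) * ⌊a ^ k⌋₊ := by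
  have h := tendsto_floor_pow_succ_div_floor_pow ha
  have h1 := h.eventually (Icc_mem_nhds (show 1 + (a - 1) / 2 < a by linarith)
    (show a < a + 1 by linarith))
  obtain ⟨K, hK⟩ := eventually_atTop.1 h1
  refine ⟨K, fun k hk => ?_⟩
  have hf : 1 ≤ ⌊a ^ k⌋₊ := Nat.one_le_floor_iff _ |>.2 (one_le_pow₀ ha.le)
  have hf' : (0 : ℝ) < ⌊a ^ k⌋₊ := by exact_mod_cast hf
  obtain ⟨h2, h3⟩ := hK k hk
  exact ⟨(le_div_iff₀ hf').1 h2, (div_le_iff₀ hf').1 h3⟩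

/-- Schlömilch condensation along a sequence `u` growing by factors in `[1 + δ, 1 + M]`, for a
series of the form `∑ g n / n` with `g` antitone. -/
lemma summable_div_iff_summable_comp {u : ℕ → ℕ} {g : ℕ → ℝ} {δ M : ℝ} (hδ : 0 < δ)
    (hu : ∀ k, 0 < u k) (hlow : ∀ k, (1 + δ) * (u k : ℝ) ≤ u (k + 1))
    (hup : ∀ k, (u (k + 1) : ℝ) ≤ (1 + M) * u k) (hg : Antitone g) (hg0 : ∀ n, 0 ≤ g n) :
    (Summable fun n : ℕ => g n / n) ↔ Summable fun k => g (u k) := by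
  have hu' : ∀ k, (0 : ℝ) < u k := fun k => by exact_mod_cast hu k
  have hM : 0 < M := by nlinarith [hlow 0, hup 0, hu' 0, mul_pos hδ (hu' 0)]
  have hstrict : StrictMono u := strictMono_nat_of_lt_succ fun k => by
    have : (u k : ℝ) < u (k + 1) := by nlinarith [hlow k, mul_pos hδ (hu' k)]
    exact_mod_cast this
  obtain ⟨C, hC⟩ := exists_nat_gt (M * (1 + M) / δ)
  have hC0 : (0 : ℝ) < C := lt_of_le_of_lt (by positivity) hC
  have hC' : M * (1 + M) ≤ C * δ := ((div_lt_iff₀ hδ).1 hC).le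
  have hdiff : SuccDiffBounded C u := fun k => by
    have h1 : (u (k + 2) : ℝ) - u (k + 1) ≤ C * (u (k + 1) - u k) := calc
      (u (k + 2) : ℝ) - u (k + 1) ≤ M * u (k + 1) := by linarith [hup (k + 1)]
      _ ≤ M * ((1 + M) * u k) := by gcongr; exact hup k
      _ = M * (1 + M) * u k := by ring
      _ ≤ C * δ * u k := by gcongr
      _ = C * (δ * u k) := by ring
      _ ≤ _ := by gcongr; linarith [hlow k]
    have h2 : u k ≤ u (k + 1) := (hstrict k.lt_succ_self).le
    have h3 : u (k + 1) ≤ u (k + 2) := (hstrict (k + 1).lt_succ_self).le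
    rw [smul_eq_mul, ← Nat.cast_le (α := ℝ), Nat.cast_mul, Nat.cast_sub h3, Nat.cast_sub h2]
    exact h1
  rw [← summable_schlomilch_iff_of_nonneg (C := C) (u := u) (f := fun n : ℕ => g n / n)
    (fun n => div_nonneg (hg0 n) n.cast_nonneg) ?_ hu hstrict (by exact_mod_cast hC0.ne') hdiff]
  · have key : ∀ k, ((u (k + 1) : ℝ) - u k) * (g (u k) / u k)
        = ((u (k + 1) : ℝ) / u k - 1) * g (u k) := fun k => by
      have := (hu' k).ne'
      field_simp
    have hl : ∀ k, δ ≤ (u (k + 1) : ℝ) / u k - 1 := fun k => by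
      have := (le_div_iff₀ (hu' k)).2 (hlow k); linarith
    have hr : ∀ k, (u (k + 1) : ℝ) / u k - 1 ≤ M := fun k => by
      have := (div_le_iff₀ (hu' k)).2 (hup k); linarith
    simp only [key]
    constructor
    · intro h
      refine (h.mul_left δ⁻¹).of_nonneg_of_le (fun k => hg0 _) fun k => ?_
      rw [← div_eq_inv_mul, le_div_iff₀ hδ, mul_comm]
      exact mul_le_mul_of_nonneg_right (hl k) (hg0 _)
    · intro h
      exact (h.mul_left M).of_nonneg_of_le
        (fun k => mul_nonneg (hδ.le.trans (hl k)) (hg0 _))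
        fun k => mul_le_mul_of_nonneg_right (hr k) (hg0 _)
  · intro m n hm hmn
    have hm' : (0 : ℝ) < m := by exact_mod_cast hm
    exact div_le_div₀ (hg0 _) (hg hmn) hm' (by exact_mod_cast hmn)

/-- Proposition 8.1 (Cauchy condensation for the Robbins–Siegmund series). -/
theorem stmt17
    (b : ℕ → ℝ) (hb : ∀ n, 0 < b n)
    (hmono : Monotone fun n : ℕ => (n : ℝ) * b n)
    (a θ : ℝ) (ha : 1 < a) (hθ : 0 < θ) :
    (Summable (fun k : ℕ => Real.exp (-(θ * (⌊a ^ k⌋₊ : ℝ) * b ⌊a ^ (k+1)⌋₊))) →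
      Summable fun n : ℕ => b n * Real.exp (-((n : ℝ) * θ * b n))) ∧
    (Summable (fun n : ℕ => b n * Real.exp (-((n : ℝ) * θ * b n))) →
      Summable fun k : ℕ => Real.exp (-(θ * (⌊a ^ k⌋₊ : ℝ) * b ⌊a ^ k⌋₊))) := by
  obtain ⟨K, hK⟩ := exists_floor_pow_succ_bounds ha
  have hpos : ∀ k : ℕ, 0 < ⌊a ^ k⌋₊ := fun k =>
    Nat.one_le_floor_iff _ |>.2 (one_le_pow₀ ha.le)
  set δ := (a - 1) / 2 with hδ_def
  have hδ : 0 < δ := by rw [hδ_def]; linarith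
  have condensation : ∀ t : ℝ, 0 ≤ t →
      ((Summable fun n : ℕ => Real.exp (-(t * (n * b n))) / n) ↔
        Summable fun k : ℕ => Real.exp (-(t * (⌊a ^ k⌋₊ * b ⌊a ^ k⌋₊)))) := fun t ht => by
    rw [← summable_nat_add_iff (f := fun k : ℕ => Real.exp (-(t * (⌊a ^ k⌋₊ * b ⌊a ^ k⌋₊)))) K]
    refine summable_div_iff_summable_comp (u := fun k => ⌊a ^ (k + K)⌋₊)
      (g := fun n => Real.exp (-(t * (n * b n)))) (M := a) hδ (fun k => hpos _) (fun k => ?_)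
      (fun k => ?_) (fun m n hmn => ?_) (fun n => (Real.exp_pos _).le)
    · have := (hK (k + K) (Nat.le_add_left _ _)).1
      rwa [add_right_comm] at this
    · have := (hK (k + K) (Nat.le_add_left _ _)).2
      rwa [add_right_comm, add_comm a 1] at this
    · exact Real.exp_le_exp.2 (neg_le_neg (mul_le_mul_of_nonneg_left (hmono hmn) ht))
  constructor
  · intro h
    have hρ : 0 < θ / (1 + δ) := by positivity
    have h1 : Summable fun k : ℕ =>
        Real.exp (-(θ / (1 + δ) * (⌊a ^ k⌋₊ * b ⌊a ^ k⌋₊))) := by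
      rw [← summable_nat_add_iff (K + 1)]
      refine ((summable_nat_add_iff K).2 h).of_nonneg_of_le (fun k => (Real.exp_pos _).le)
        fun k => Real.exp_le_exp.2 (neg_le_neg ?_)
      have h2 := (hK (k + K) (Nat.le_add_left _ _)).1
      rw [← add_assoc, ← mul_assoc]
      refine mul_le_mul_of_nonneg_right ?_ (hb _).le
      rw [div_mul_eq_mul_div, le_div_iff₀ (by positivity), mul_assoc]
      refine mul_le_mul_of_nonneg_left ?_ hθ.le
      rwa [mul_comm]
    have hs : 0 < θ - θ / (1 + δ) := by
      rw [sub_pos, div_lt_iff₀ (by positivity)]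
      nlinarith [mul_pos hθ hδ]
    have h2 := ((condensation _ hρ.le).2 h1).mul_left (θ - θ / (1 + δ))⁻¹
    rw [← summable_nat_add_iff 1] at h2 ⊢
    refine h2.of_nonneg_of_le (fun n => mul_nonneg (hb _).le (Real.exp_pos _).le) fun n => ?_
    have hn : (0 : ℝ) < ((n + 1 : ℕ) : ℝ) := by positivity
    set c := ((n + 1 : ℕ) : ℝ) * b (n + 1) with hc
    have hexp : (θ - θ / (1 + δ)) * c ≤ Real.exp ((θ - θ / (1 + δ)) * c) := by
      linarith [Real.add_one_le_exp ((θ - θ / (1 + δ)) * c)]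
    have hsplit : Real.exp (-(θ / (1 + δ) * c)) =
        Real.exp ((θ - θ / (1 + δ)) * c) * Real.exp (-(θ * c)) := by
      rw [← Real.exp_add]
      congr 1
      ring
    rw [show ((n + 1 : ℕ) : ℝ) * θ * b (n + 1) = θ * c by rw [hc]; ring, ← div_eq_inv_mul,
      le_div_iff₀ hs, le_div_iff₀ hn, hsplit]
    calc b (n + 1) * Real.exp (-(θ * c)) * (θ - θ / (1 + δ)) * ((n + 1 : ℕ) : ℝ)
        = (θ - θ / (1 + δ)) * c * Real.exp (-(θ * c)) := by rw [hc]; ring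
      _ ≤ _ := mul_le_mul_of_nonneg_right hexp (Real.exp_pos _).le
  · intro h
    have hc : 0 < b 1 := hb 1
    have h1 : Summable fun n : ℕ => Real.exp (-(θ * (n * b n))) / n := by
      rw [← summable_nat_add_iff 1] at h ⊢
      refine (h.mul_left (b 1)⁻¹).of_nonneg_of_le (fun n => by positivity) fun n => ?_
      have h2 := hmono (show 1 ≤ n + 1 by omega)
      simp only [Nat.cast_one, one_mul] at h2
      have hn : (0 : ℝ) < ((n + 1 : ℕ) : ℝ) := by positivity
      rw [← div_eq_inv_mul, div_le_div_iff₀ hn hc,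
        show ((n + 1 : ℕ) : ℝ) * θ * b (n + 1) = θ * ((n + 1 : ℕ) * b (n + 1)) by ring]
      nlinarith [mul_le_mul_of_nonneg_left h2
        (Real.exp_pos (-(θ * ((n + 1 : ℕ) * b (n + 1))))).le]
    simpa only [mul_assoc] using (condensation θ hθ.le).1 h1
end

section
/- Let f : [0,1] → [0,1] preserve a probability measure μ, and suppose correlations decay exponentially for L^∞ against BV: there exist C, τ > 0 such that for all φ ∈ L^∞(μ) and ψ of bounded variation, |∫ (φ∘f^n)·ψ dμ − ∫φ dμ ∫ψ dμ| ≤ C e^{−τ n} sup|φ| · ‖ψ‖_BV. Assume also that there are constants c, s > 0 such that μ(B(x,r)) ≤ c r^s for every x ∈ [0,1] and r > 0. Then there exist a constant D and η ∈ (0,τ) such that for every r > 0 and n ≥ 1, the set E_{r,n} = { x : |f^n(x) − x| < r } satisfies μ(E_{r,n}) ≤ ∫ μ(B(x,r)) dμ(x) + D e^{−η n} ≤ c r^s + D e^{−η n}. -/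
open MeasureTheory Filter Metric Set

/-- The bounded-variation norm `var(g) + sup |g|` of `g` on a set `s ⊆ ℝ`. -/
noncomputable def bvNorm (s : Set ℝ) (g : ℝ → ℝ) : ℝ :=
  (eVariationOn g s).toReal + ⨆ x ∈ s, |g x|

theorem eVariationOn_sub_le (p q : ℝ → ℝ) (s : Set ℝ) :
    eVariationOn (fun x => p x - q x) s ≤ eVariationOn p s + eVariationOn q s := by
  refine iSup_le fun ⟨n, u, hu, us⟩ => ?_
  calc ∑ i ∈ Finset.range n, edist (p (u (i + 1)) - q (u (i + 1))) (p (u i) - q (u i))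
      ≤ ∑ i ∈ Finset.range n,
          (edist (p (u (i + 1))) (p (u i)) + edist (q (u (i + 1))) (q (u i))) := by
        refine Finset.sum_le_sum fun i _ => ?_
        simp only [edist_dist, Real.dist_eq]
        rw [← ENNReal.ofReal_add (abs_nonneg _) (abs_nonneg _)]
        refine ENNReal.ofReal_le_ofReal ?_
        rw [show ∀ a b c d : ℝ, a - b - (c - d) = (a - c) - (b - d) by intros; ring]
        exact abs_sub _ _
    _ ≤ eVariationOn p s + eVariationOn q s := by
        rw [Finset.sum_add_distrib]
        exact add_le_add (eVariationOn.sum_le hu us) (eVariationOn.sum_le hu us)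

theorem eVariationOn_indicator_Ici_le (a : ℝ) :
    eVariationOn ((Ici a).indicator fun _ => (1 : ℝ)) (Icc 0 1) ≤ 1 := by
  have hmono : Monotone ((Ici a).indicator fun _ => (1 : ℝ)) := by
    intro x y hxy
    simp only [indicator, mem_Ici]
    split_ifs <;> linarith
  have h := ((hmono.monotoneOn (Icc (0 : ℝ) 1)).eVariationOn_eq
    (left_mem_Icc.2 zero_le_one) (right_mem_Icc.2 zero_le_one)).le
  rw [inter_self] at h
  refine h.trans (ENNReal.ofReal_le_one.2 ?_)
  simp only [indicator]
  split_ifs <;> norm_num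

theorem eVariationOn_indicator_Ico_le {a b : ℝ} (hab : a ≤ b) :
    eVariationOn ((Ico a b).indicator fun _ => (1 : ℝ)) (Icc 0 1) ≤ 2 := by
  have h : ((Ico a b).indicator fun _ => (1 : ℝ)) =
      fun x => (Ici a).indicator (fun _ => (1 : ℝ)) x - (Ici b).indicator (fun _ => (1 : ℝ)) x := by
    ext x
    simp only [indicator, mem_Ico, mem_Ici]
    split_ifs <;> grind
  rw [h, ← one_add_one_eq_two]
  exact (eVariationOn_sub_le _ _ _).trans
    (add_le_add (eVariationOn_indicator_Ici_le a) (eVariationOn_indicator_Ici_le b))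

theorem bvNorm_indicator_Ico_le {a b : ℝ} (hab : a ≤ b) :
    bvNorm (Icc 0 1) ((Ico a b).indicator fun _ => (1 : ℝ)) ≤ 3 := by
  have h1 : (eVariationOn ((Ico a b).indicator fun _ => (1 : ℝ)) (Icc 0 1)).toReal ≤ 2 :=
    ENNReal.toReal_le_of_le_ofReal (by norm_num)
      ((eVariationOn_indicator_Ico_le hab).trans (by simp))
  have h2 : ⨆ x ∈ Icc (0 : ℝ) 1, |(Ico a b).indicator (fun _ => (1 : ℝ)) x| ≤ 1 := by
    refine Real.iSup_le (fun x => Real.iSup_le (fun _ => ?_) zero_le_one) zero_le_one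
    simp only [indicator]
    split_ifs <;> norm_num
  unfold bvNorm
  linarith

theorem measurable_measureReal_ball (μ : Measure ℝ) [IsProbabilityMeasure μ] (r : ℝ) :
    Measurable fun x => μ.real (ball x r) := by
  have hS : MeasurableSet {p : ℝ × ℝ | dist p.2 p.1 < r} :=
    measurableSet_lt (measurable_snd.dist measurable_fst) measurable_const
  exact (measurable_measure_prodMk_left (ν := μ) hS).ennreal_toReal

theorem integrable_measureReal_ball (μ : Measure ℝ) [IsProbabilityMeasure μ] (r : ℝ) :
    Integrable (fun x => μ.real (ball x r)) μ := by
  refine Integrable.of_bound (measurable_measureReal_ball μ r).aestronglyMeasurable 1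
    (Eventually.of_forall fun x => ?_)
  rw [Real.norm_of_nonneg measureReal_nonneg]
  exact measureReal_le_one

/-- Under the ball regularity `μ(B(x,δ)) ≤ ε`, enlarging the radius of a ball by `δ` adds at most
`2 ε` to its measure. -/
theorem measureReal_ball_add_le (μ : Measure ℝ) [IsProbabilityMeasure μ] {δ ε : ℝ} (hδ : 0 < δ)
    (hball : ∀ x, μ.real (ball x δ) ≤ ε) (x r : ℝ) :
    μ.real (ball x (r + δ)) ≤ μ.real (ball x r) + 2 * ε := by
  have hsub : ball x (r + δ) ⊆
      ball x r ∪ (ball (x + r + δ / 2) δ ∪ ball (x - r - δ / 2) δ) := by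
    intro y hy
    simp only [mem_union, mem_ball, Real.dist_eq, abs_lt] at hy ⊢
    grind
  have h1 := measureReal_mono (μ := μ) hsub
  have h2 := measureReal_union_le (μ := μ) (ball x r)
    (ball (x + r + δ / 2) δ ∪ ball (x - r - δ / 2) δ)
  have h3 := measureReal_union_le (μ := μ) (ball (x + r + δ / 2) δ) (ball (x - r - δ / 2) δ)
  linarith [hball (x + r + δ / 2), hball (x - r - δ / 2)]

/-- Decay of correlations tested on the indicators of a measurable set and an interval. -/
theorem measureReal_Ico_inter_preimage_le {F : ℝ → ℝ} (hF : Measurable F)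
    (μ : Measure ℝ) [IsProbabilityMeasure μ] {K : ℝ} (hK : 0 ≤ K)
    (hdecay : ∀ g h : ℝ → ℝ, (∀ x, |g x| ≤ 1) → BoundedVariationOn h (Icc 0 1) →
      |(∫ x, g (F x) * h x ∂μ) - (∫ x, g x ∂μ) * ∫ x, h x ∂μ| ≤ K * bvNorm (Icc 0 1) h)
    {a b : ℝ} (hab : a ≤ b) {B : Set ℝ} (hB : MeasurableSet B) :
    μ.real (Ico a b ∩ F ⁻¹' B) ≤ μ.real (Ico a b) * μ.real B + 3 * K := by
  have hbv : BoundedVariationOn ((Ico a b).indicator fun _ => (1 : ℝ)) (Icc 0 1) :=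
    ((eVariationOn_indicator_Ico_le hab).trans_lt (by simp)).ne
  have hg : ∀ x, |B.indicator (fun _ => (1 : ℝ)) x| ≤ 1 := by
    intro x
    simp only [indicator]
    split_ifs <;> norm_num
  have h := hdecay _ _ hg hbv
  have hprod : (fun x => B.indicator (fun _ => (1 : ℝ)) (F x) *
      (Ico a b).indicator (fun _ => (1 : ℝ)) x) =
      (Ico a b ∩ F ⁻¹' B).indicator fun _ => (1 : ℝ) := by
    ext x
    by_cases h1 : x ∈ Ico a b <;> by_cases h2 : F x ∈ B <;> simp [indicator, h1, h2]
  rw [hprod, integral_indicator_const _ (measurableSet_Ico.inter (hF hB)),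
    integral_indicator_const _ hB, integral_indicator_const _ measurableSet_Ico] at h
  simp only [smul_eq_mul, mul_one] at h
  have h1 := (abs_le.1 h).2
  have h2 := mul_le_mul_of_nonneg_left (bvNorm_indicator_Ico_le hab) hK
  linarith

/-- Partitioning `[0,1]` at scale `1 / N` bounds the measure of close returns. -/
theorem measureReal_close_return_le {F : ℝ → ℝ} (hF : Measurable F)
    (μ : Measure ℝ) [IsProbabilityMeasure μ] (hX1 : μ (Icc 0 1) = 1) {K : ℝ} (hK : 0 ≤ K)
    (hdecay : ∀ g h : ℝ → ℝ, (∀ x, |g x| ≤ 1) → BoundedVariationOn h (Icc 0 1) →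
      |(∫ x, g (F x) * h x ∂μ) - (∫ x, g x ∂μ) * ∫ x, h x ∂μ| ≤ K * bvNorm (Icc 0 1) h)
    {N : ℕ} (hN : 0 < N) {ε : ℝ} (hball : ∀ x, μ.real (ball x (1 / N)) ≤ ε) (r : ℝ) :
    μ.real {x | |F x - x| < r} ≤
      (∫ x, μ.real (ball x r) ∂μ) + 2 * ε + (N + 1) * (3 * K) := by
  have hN' : (0 : ℝ) < N := Nat.cast_pos.2 hN
  set I : ℕ → Set ℝ := fun k => Ico ((k : ℝ) / N) ((k + 1 : ℝ) / N) with hI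
  set B : ℕ → Set ℝ := fun k => Ioo ((k : ℝ) / N - r) ((k + 1 : ℝ) / N + r) with hB
  have hmemI : ∀ k x, x ∈ I k → (k : ℝ) ≤ x * N ∧ x * N < k + 1 := by
    intro k x hx
    exact ⟨(div_le_iff₀ hN').1 hx.1, (lt_div_iff₀ hN').1 hx.2⟩
  have hdisj : Pairwise (Function.onFun Disjoint I) := by
    intro j k hjk
    refine Set.disjoint_left.2 fun x hj hk => hjk ?_
    obtain ⟨hj1, hj2⟩ := hmemI j x hj
    obtain ⟨hk1, hk2⟩ := hmemI k x hk
    have h1 : j < k + 1 := by exact_mod_cast hj1.trans_lt hk2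
    have h2 : k < j + 1 := by exact_mod_cast hk1.trans_lt hj2
    omega
  have hcover : Icc (0 : ℝ) 1 ⊆ ⋃ k ∈ Finset.range (N + 1), I k := by
    intro x hx
    have hx0 : 0 ≤ x * N := mul_nonneg hx.1 hN'.le
    refine mem_biUnion (x := ⌊x * N⌋₊) ?_ ?_
    · have h : ⌊x * N⌋₊ ≤ N := Nat.floor_le_of_le (by nlinarith [hx.2])
      simp only [Finset.coe_range, mem_Iio]
      omega
    · exact ⟨(div_le_iff₀ hN').2 (Nat.floor_le hx0), (lt_div_iff₀ hN').2 (Nat.lt_floor_add_one _)⟩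
  have hnull : μ (Icc (0 : ℝ) 1)ᶜ = 0 := (prob_compl_eq_zero_iff measurableSet_Icc).2 hX1
  have hE : μ.real {x | |F x - x| < r} ≤
      μ.real (⋃ k ∈ Finset.range (N + 1), I k ∩ F ⁻¹' B k) := by
    refine ENNReal.toReal_mono (measure_ne_top _ _) (measure_mono_ae ?_)
    filter_upwards [mem_ae_iff.2 hnull] with x hx hxE
    obtain ⟨k, hk, hxk⟩ := mem_iUnion₂.1 (hcover hx)
    refine mem_iUnion₂.2 ⟨k, hk, hxk, ?_⟩
    have h := abs_lt.1 (show |F x - x| < r from hxE)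
    exact ⟨by linarith [hxk.1], by linarith [hxk.2]⟩
  have hone : ∀ k, μ.real (I k ∩ F ⁻¹' B k) ≤
      (∫ x in I k, (μ.real (ball x r) + 2 * ε) ∂μ) + 3 * K := by
    intro k
    have hle : μ.real (I k) * μ.real (B k) ≤ ∫ x in I k, (μ.real (ball x r) + 2 * ε) ∂μ := by
      rw [← smul_eq_mul, ← setIntegral_const]
      refine setIntegral_mono_on (integrable_const _)
        ((integrable_measureReal_ball μ r).add (integrable_const _)).integrableOn
        measurableSet_Ico fun x hx => ?_
      refine le_trans (measureReal_mono ?_) (measureReal_ball_add_le μ (by positivity) hball x r)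
      intro y hy
      have hadd : ((k : ℝ) + 1) / N = k / N + 1 / N := add_div _ _ _
      rw [mem_ball, Real.dist_eq, abs_lt]
      constructor <;> linarith [hx.1, hx.2, hy.1, hy.2]
    have hcor := measureReal_Ico_inter_preimage_le hF μ hK hdecay
      (show (k : ℝ) / N ≤ (k + 1 : ℝ) / N by gcongr; linarith) (B := B k) measurableSet_Ioo
    linarith
  have hint : Integrable (fun x => μ.real (ball x r) + 2 * ε) μ :=
    (integrable_measureReal_ball μ r).add (integrable_const _)
  have hsum : ∑ k ∈ Finset.range (N + 1), ∫ x in I k, (μ.real (ball x r) + 2 * ε) ∂μ =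
      (∫ x, μ.real (ball x r) ∂μ) + 2 * ε := by
    rw [← integral_biUnion_finset _ (fun _ _ => measurableSet_Ico)
      (fun j _ k _ hjk => hdisj hjk) (fun _ _ => hint.integrableOn)]
    have hae : (⋃ k ∈ Finset.range (N + 1), I k) =ᵐ[μ] univ := by
      rw [ae_eq_univ]
      exact measure_mono_null (compl_subset_compl.2 hcover) hnull
    rw [setIntegral_congr_set hae, setIntegral_univ,
      integral_add (integrable_measureReal_ball μ r) (integrable_const _)]
    simp
  calc μ.real {x | |F x - x| < r}
      ≤ ∑ k ∈ Finset.range (N + 1), μ.real (I k ∩ F ⁻¹' B k) :=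
        hE.trans (measureReal_biUnion_finset_le _ _)
    _ ≤ ∑ k ∈ Finset.range (N + 1),
          ((∫ x in I k, (μ.real (ball x r) + 2 * ε) ∂μ) + 3 * K) :=
        Finset.sum_le_sum fun k _ => hone k
    _ = (∫ x, μ.real (ball x r) ∂μ) + 2 * ε + (N + 1) * (3 * K) := by
        rw [Finset.sum_add_distrib, hsum]
        simp

/-- Lemma B.2: under exponential decay of correlations (`L^∞` against BV) and
the ball regularity `μ(B(x,r)) ≤ c r^s`, the set of `r`-close returns at time `n`,
`E_{r,n} = {x : |fⁿ(x) − x| < r}`, satisfies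
`μ(E_{r,n}) ≤ ∫ μ(B(x,r)) dμ(x) + D e^{−ηn} ≤ c r^s + D e^{−ηn}`. -/
theorem stmt19
    (f : ℝ → ℝ) (hmaps : MapsTo f (Icc 0 1) (Icc 0 1))
    (μ : Measure ℝ) [IsProbabilityMeasure μ] (hf : MeasurePreserving f μ μ)
    (hX1 : μ (Icc 0 1) = 1)
    (C τ : ℝ) (hC : 0 < C) (hτ : 0 < τ)
    (hdecay : ∀ (g h : ℝ → ℝ) (G : ℝ), (∀ x, |g x| ≤ G) →
      BoundedVariationOn h (Icc 0 1) →
      ∀ n : ℕ, 1 ≤ n →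
        |(∫ x, g (f^[n] x) * h x ∂μ) - (∫ x, g x ∂μ) * ∫ x, h x ∂μ| ≤
          C * Real.exp (-τ * n) * G * bvNorm (Icc 0 1) h)
    (c s : ℝ) (hc : 0 < c) (hs : 0 < s)
    (hball : ∀ (x : ℝ) (ρ : ℝ), 0 < ρ → μ (ball x ρ) ≤ ENNReal.ofReal (c * ρ ^ s)) :
    ∃ D : ℝ, ∃ η : ℝ, η ∈ Ioo 0 τ ∧
      ∀ ρ : ℝ, 0 < ρ → ∀ n : ℕ, 1 ≤ n →
        (μ {x | |f^[n] x - x| < ρ}).toReal ≤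
            (∫ x, (μ (ball x ρ)).toReal ∂μ) + D * Real.exp (-η * n) ∧
          (∫ x, (μ (ball x ρ)).toReal ∂μ) + D * Real.exp (-η * n) ≤
            c * ρ ^ s + D * Real.exp (-η * n) := by
  have hballReal : ∀ x ρ : ℝ, 0 < ρ → μ.real (ball x ρ) ≤ c * ρ ^ s := fun x ρ hρ =>
    ENNReal.toReal_le_of_le_ofReal (by positivity) (hball x ρ hρ)
  have hη : 0 < min s 1 * τ / 2 := by positivity
  refine ⟨2 * c + 9 * C, min s 1 * τ / 2, ⟨hη, ?_⟩, fun ρ hρ n hn => ⟨?_, ?_⟩⟩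
  · nlinarith [min_le_right s 1]
  · set N : ℕ := ⌈Real.exp (τ * n / 2)⌉₊ with hNdef
    have hN : 0 < N := Nat.ceil_pos.2 (Real.exp_pos _)
    have hN' : (0 : ℝ) < N := Nat.cast_pos.2 hN
    have hNge : Real.exp (τ * n / 2) ≤ N := Nat.le_ceil _
    have hNlt : (N : ℝ) < Real.exp (τ * n / 2) + 1 := Nat.ceil_lt_add_one (Real.exp_pos _).le
    have hexp1 : 1 ≤ Real.exp (τ * n / 2) := Real.one_le_exp (by positivity)
    have hn0 : (0 : ℝ) ≤ τ * n / 2 := by positivity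
    have hmain := measureReal_close_return_le (hf.measurable.iterate n) μ hX1
      (K := C * Real.exp (-τ * n)) (by positivity)
      (fun g h hg hh => by simpa using hdecay g h 1 hg hh n hn) hN
      (fun x => hballReal x (1 / N) (by positivity)) ρ
    have hscale : (1 / (N : ℝ)) ^ s ≤ Real.exp (-(min s 1 * τ / 2) * n) := by
      calc (1 / (N : ℝ)) ^ s ≤ (Real.exp (-(τ * n / 2))) ^ s := by
            refine Real.rpow_le_rpow (by positivity) ?_ hs.le
            rw [Real.exp_neg, one_div]
            exact inv_anti₀ (Real.exp_pos _) hNge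
        _ = Real.exp (-(τ * n / 2) * s) := (Real.exp_mul _ _).symm
        _ ≤ Real.exp (-(min s 1 * τ / 2) * n) :=
            Real.exp_le_exp.2 (by nlinarith [min_le_left s 1])
    have hcount : ((N : ℝ) + 1) * Real.exp (-τ * n) ≤
        3 * Real.exp (-(min s 1 * τ / 2) * n) := by
      calc ((N : ℝ) + 1) * Real.exp (-τ * n)
          ≤ (3 * Real.exp (τ * n / 2)) * Real.exp (-τ * n) := by gcongr; linarith
        _ = 3 * Real.exp (-(τ * n / 2)) := by
            rw [mul_assoc, ← Real.exp_add]
            ring_nf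
        _ ≤ 3 * Real.exp (-(min s 1 * τ / 2) * n) := by
            refine mul_le_mul_of_nonneg_left (Real.exp_le_exp.2 ?_) (by norm_num)
            nlinarith [min_le_right s 1]
    have h1 := mul_le_mul_of_nonneg_left hscale hc.le
    have h2 := mul_le_mul_of_nonneg_left hcount hC.le
    simp only [measureReal_def] at hmain
    linarith
  · have h := integral_mono (integrable_measureReal_ball μ ρ) (integrable_const (c * ρ ^ s))
      fun x => hballReal x ρ hρ
    rw [integral_const, probReal_univ, one_smul] at h
    simp only [measureReal_def] at h
    linarith
end
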